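/- Exponential speed of selection: in the QND setting, conditionally on $\{\Upsilon = \gamma\}$ the outcomes $(i_k)$ are i.i.d. with law $p(\cdot|\gamma)$, and for any $\alpha$ with $q_\alpha(0) \ne 0$, almost surely $\frac{1}{n}\ln\big(q_\alpha(n)/q_\Upsilon(n)\big) \to -S(\mathbb{P}_\Upsilon \| \mathbb{P}_\alpha)$, where $S(\mathbb{P}_\gamma\|\mathbb{P}_\alpha) = \sum_i p(i|\gamma)\ln(p(i|\gamma)/p(i|\alpha))$. -/

import Mathlib

open Matrix MeasureTheory Filter
open scoped BigOperators ComplexOrder Topology ENNReal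

/-- The imperfect-measurement Kraus map `Φ_i(ρ) = ∑_j η_{ij} V_j ρ V_j†`. -/
noncomputable def Phi {d : ℕ} {Y : Type*} [Fintype Y]
    (η : Y → Y → ℝ) (V : Y → Matrix (Fin d) (Fin d) ℂ) (i : Y)
    (ρ : Matrix (Fin d) (Fin d) ℂ) : Matrix (Fin d) (Fin d) ℂ :=
  ∑ j, (η i j : ℂ) • (V j * ρ * (V j)ᴴ)

/-- The rank-one projector `|α⟩⟨α|` onto the pointer vector `v α`. -/
def proj {d : ℕ} {P : Type*} (v : P → (Fin d → ℂ)) (α : P) :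
    Matrix (Fin d) (Fin d) ℂ :=
  Matrix.vecMulVec (v α) (star (v α))

/-- The quantum trajectory `ρ_{n+1} = Φ_{ω_n}(ρ_n)/tr(Φ_{ω_n}(ρ_n))` starting
from `ρ0`, along the outcome sequence `ω`. -/
noncomputable def traj {d : ℕ} {Y : Type*} [Fintype Y]
    (η : Y → Y → ℝ) (V : Y → Matrix (Fin d) (Fin d) ℂ)
    (ρ0 : Matrix (Fin d) (Fin d) ℂ) : ℕ → (ℕ → Y) → Matrix (Fin d) (Fin d) ℂ
  | 0, _ => ρ0
  | n + 1, ω =>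
      ((Phi η V (ω n) (traj η V ρ0 n ω)).trace)⁻¹ • Phi η V (ω n) (traj η V ρ0 n ω)

/-- The unnormalized evolution of `ρ0` along a finite word of outcomes. -/
noncomputable def evolve {d : ℕ} {Y : Type*} [Fintype Y]
    (η : Y → Y → ℝ) (V : Y → Matrix (Fin d) (Fin d) ℂ)
    (ρ0 : Matrix (Fin d) (Fin d) ℂ) (l : List Y) : Matrix (Fin d) (Fin d) ℂ :=
  l.foldl (fun ρ i => Phi η V i ρ) ρ0

/-- The cylinder set of outcome sequences starting with the word `w`. -/
def cyl {Y : Type*} {n : ℕ} (w : Fin n → Y) : Set (ℕ → Y) :=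
  {ω | ∀ k : Fin n, ω (k : ℕ) = w k}

open ProbabilityTheory

section Helpers

lemma cyl_meas {Y : Type*} [MeasurableSpace Y] [MeasurableSingletonClass Y] {n : ℕ}
    (w : Fin n → Y) : MeasurableSet (cyl w) := by
  have : cyl w = ⋂ k : Fin n, (fun ω : ℕ → Y => ω (k : ℕ)) ⁻¹' {w k} := by
    ext ω; simp [cyl]
  rw [this]
  exact MeasurableSet.iInter fun k => (measurable_pi_apply _) (measurableSet_singleton _)

/-- Unnormalized weight. -/
noncomputable def wgt {Y P : Type*} (p : Y → P → ℝ) (q0 : P → ℝ) (n : ℕ) (ω : ℕ → Y) (α : P) : ℝ :=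
  (∏ k ∈ Finset.range n, p (ω k) α) * q0 α

/-- Normalized weight. -/
noncomputable def nwgt {Y P : Type*} [Fintype P] (p : Y → P → ℝ) (q0 : P → ℝ) (n : ℕ)
    (ω : ℕ → Y) (α : P) : ℝ :=
  wgt p q0 n ω α / ∑ β, wgt p q0 n ω β

lemma wgt_nonneg {Y P : Type*} {p : Y → P → ℝ} {q0 : P → ℝ} (hp : ∀ i α, 0 ≤ p i α)
    (hq : ∀ α, 0 ≤ q0 α) (n : ℕ) (ω : ℕ → Y) (α : P) : 0 ≤ wgt p q0 n ω α :=
  mul_nonneg (Finset.prod_nonneg fun _ _ => hp _ _) (hq _)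

lemma wgt_meas {Y P : Type*} [Fintype Y] [MeasurableSpace Y] [MeasurableSingletonClass Y]
    (p : Y → P → ℝ) (q0 : P → ℝ) (n : ℕ) (α : P) :
    Measurable (fun ω : ℕ → Y => wgt p q0 n ω α) := by
  unfold wgt
  refine Measurable.mul_const ?_ _
  refine Finset.measurable_fun_prod _ fun k _ => ?_
  exact (Measurable.of_discrete (f := fun i : Y => p i α)).comp (measurable_pi_apply k)

lemma nwgt_meas {Y P : Type*} [Fintype Y] [Fintype P] [MeasurableSpace Y]
    [MeasurableSingletonClass Y]
    (p : Y → P → ℝ) (q0 : P → ℝ) (n : ℕ) (α : P) :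
    Measurable (fun ω : ℕ → Y => nwgt p q0 n ω α) := by
  unfold nwgt
  exact (wgt_meas p q0 n α).div (Finset.measurable_fun_sum _ fun β _ => wgt_meas p q0 n β)

lemma wgt_cyl {Y P : Type*} (p : Y → P → ℝ) (q0 : P → ℝ) (n : ℕ) (w : Fin n → Y) (ω : ℕ → Y)
    (h : ω ∈ cyl w) (α : P) : wgt p q0 n ω α = (∏ k, p (w k) α) * q0 α := by
  unfold wgt
  rw [Finset.prod_range]
  congr 1
  exact Finset.prod_congr rfl fun k _ => by rw [h k]

lemma cyl_snoc {Y : Type*} {n : ℕ} (w : Fin n → Y) :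
    cyl w = ⋃ i : Y, cyl (Fin.snoc w i : Fin (n + 1) → Y) := by
  ext ω
  simp [cyl, Fin.forall_fin_succ']

lemma int_cyl {Y P : Type*} [Fintype Y] [Fintype P]
    [MeasurableSpace Y] [MeasurableSingletonClass Y]
    (p : Y → P → ℝ) (q0 : P → ℝ) (hp : ∀ i α, 0 ≤ p i α) (hp1 : ∀ α, ∑ i, p i α = 1)
    (hq : ∀ α, 0 ≤ q0 α)
    (μ : Measure (ℕ → Y))
    (h_law : ∀ (n : ℕ) (w : Fin n → Y),
      μ (cyl w) = ENNReal.ofReal (∑ α, (∏ k, p (w k) α) * q0 α)) (γ : P) (k : ℕ) :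
    ∀ (n : ℕ) (w : Fin n → Y), ∫⁻ ω in cyl w, ENNReal.ofReal (nwgt p q0 (n + k) ω γ) ∂μ
      = ENNReal.ofReal ((∏ k, p (w k) γ) * q0 γ) := by
  induction k with
  | zero =>
    intro n w
    have h0 : ∀ α, 0 ≤ (∏ k, p (w k) α) * q0 α := fun α =>
      mul_nonneg (Finset.prod_nonneg fun _ _ => hp _ _) (hq _)
    have : Set.EqOn (fun ω => ENNReal.ofReal (nwgt p q0 (n + 0) ω γ))
        (fun _ => ENNReal.ofReal (((∏ k, p (w k) γ) * q0 γ) / ∑ α, (∏ k, p (w k) α) * q0 α))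
        (cyl w) := by
      intro ω hω
      simp only [nwgt, add_zero, wgt_cyl p q0 n w ω hω]
    rw [setLIntegral_congr_fun (cyl_meas w) this, setLIntegral_const, h_law,
      ← ENNReal.ofReal_mul (div_nonneg (h0 _) (Finset.sum_nonneg fun _ _ => h0 _))]
    congr 1
    by_cases hz : ∑ α, (∏ k, p (w k) α) * q0 α = 0
    · rw [hz, (Finset.sum_eq_zero_iff_of_nonneg fun a _ => h0 a).1 hz γ (Finset.mem_univ _)]
      simp
    · exact div_mul_cancel₀ _ hz
  | succ k ih =>
    intro n w
    rw [cyl_snoc w, lintegral_iUnion (fun i => cyl_meas _), tsum_fintype]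
    · have : ∀ i : Y, ∫⁻ ω in cyl (Fin.snoc w i : Fin (n + 1) → Y),
          ENNReal.ofReal (nwgt p q0 (n + (k + 1)) ω γ) ∂μ
          = ENNReal.ofReal ((∏ k, p (w k) γ) * p i γ * q0 γ) := by
        intro i
        have := ih (n + 1) (Fin.snoc w i)
        rw [Fin.prod_univ_castSucc] at this
        simp only [Fin.snoc_castSucc, Fin.snoc_last] at this
        rw [← this, show n + (k + 1) = n + 1 + k by ring]
      simp_rw [this]
      rw [← ENNReal.ofReal_sum_of_nonneg]
      · congr 1
        rw [← Finset.sum_mul, ← Finset.mul_sum, hp1, mul_one]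
      · intro i _
        exact mul_nonneg (mul_nonneg (Finset.prod_nonneg fun _ _ => hp _ _) (hp _ _)) (hq _)
    · intro i j hij
      refine Set.disjoint_left.2 fun ω hi hj => hij ?_
      have h1 := hi (Fin.last n)
      have h2 := hj (Fin.last n)
      simp only [Fin.snoc_last] at h1 h2
      exact h1.symm.trans h2

lemma nwgt_nonneg {Y P : Type*} [Fintype P] {p : Y → P → ℝ} {q0 : P → ℝ} (hp : ∀ i α, 0 ≤ p i α)
    (hq : ∀ α, 0 ≤ q0 α) (n : ℕ) (ω : ℕ → Y) (α : P) : 0 ≤ nwgt p q0 n ω α :=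
  div_nonneg (wgt_nonneg hp hq _ _ _) (Finset.sum_nonneg fun _ _ => wgt_nonneg hp hq _ _ _)

lemma nwgt_sum_le {Y P : Type*} [Fintype P] (p : Y → P → ℝ) (q0 : P → ℝ) (n : ℕ) (ω : ℕ → Y) :
    ∑ α, nwgt p q0 n ω α ≤ 1 := by
  unfold nwgt
  rw [← Finset.sum_div]
  exact div_self_le_one _

lemma joint_law {Y P : Type*} [Fintype Y] [Fintype P] [DecidableEq P]
    [MeasurableSpace Y] [MeasurableSingletonClass Y]
    [MeasurableSpace P] [MeasurableSingletonClass P]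
    (p : Y → P → ℝ) (q0 : P → ℝ) (hp : ∀ i α, 0 ≤ p i α) (hp1 : ∀ α, ∑ i, p i α = 1)
    (hq : ∀ α, 0 ≤ q0 α)
    (μ : Measure (ℕ → Y)) [IsProbabilityMeasure μ]
    (h_law : ∀ (n : ℕ) (w : Fin n → Y),
      μ (cyl w) = ENNReal.ofReal (∑ α, (∏ k, p (w k) α) * q0 α))
    (Υ : (ℕ → Y) → P) (hΥ_meas : Measurable Υ)
    (hΥ_sel : ∀ᵐ ω ∂μ, Tendsto (fun n => nwgt p q0 n ω (Υ ω)) atTop (𝓝 1))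
    (γ : P) (n : ℕ) (w : Fin n → Y) :
    μ ({ω | Υ ω = γ} ∩ cyl w) = ENNReal.ofReal ((∏ k, p (w k) γ) * q0 γ) := by
  have hS : MeasurableSet {ω | Υ ω = γ} := hΥ_meas (measurableSet_singleton γ)
  have key : Tendsto (fun k => ∫⁻ ω in cyl w, ENNReal.ofReal (nwgt p q0 (n + k) ω γ) ∂μ) atTop
      (𝓝 (∫⁻ ω in cyl w, Set.indicator {ω | Υ ω = γ} 1 ω ∂μ)) := by
    refine tendsto_lintegral_of_dominated_convergence (fun _ => 1) ?_ ?_ ?_ ?_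
    · intro k
      exact (nwgt_meas p q0 _ γ).ennreal_ofReal
    · intro k
      refine Eventually.of_forall fun ω => ?_
      simp only [ENNReal.ofReal_le_one]
      exact (Finset.single_le_sum (f := fun α => nwgt p q0 (n + k) ω α)
        (fun a _ => nwgt_nonneg hp hq _ _ _) (Finset.mem_univ γ)).trans (nwgt_sum_le _ _ _ _)
    · simp
    · filter_upwards [ae_restrict_of_ae hΥ_sel] with ω hω
      have hω' : Tendsto (fun k => nwgt p q0 (n + k) ω (Υ ω)) atTop (𝓝 1) :=
        hω.comp (tendsto_atTop_mono (fun k => Nat.le_add_left k n) tendsto_id)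
      by_cases h : Υ ω = γ
      · rw [Set.indicator_of_mem (by exact h), h.symm]
        simpa using ENNReal.tendsto_ofReal hω'
      · rw [Set.indicator_of_notMem (by exact h)]
        have : Tendsto (fun k => nwgt p q0 (n + k) ω γ) atTop (𝓝 0) := by
          have h2 : Tendsto (fun k => 1 - nwgt p q0 (n + k) ω (Υ ω)) atTop (𝓝 0) := by
            simpa using hω'.const_sub 1
          refine squeeze_zero (fun k => nwgt_nonneg hp hq _ _ _) (fun k => ?_) h2
          have h3 := nwgt_sum_le p q0 (n + k) ω
          have h4 := Finset.sum_le_sum_of_subset_of_nonneg (Finset.subset_univ {γ, Υ ω})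
            (f := fun α => nwgt p q0 (n + k) ω α) (fun a _ _ => nwgt_nonneg hp hq _ _ _)
          rw [Finset.sum_pair (Ne.symm h)] at h4
          linarith
        simpa using ENNReal.tendsto_ofReal this
  simp_rw [int_cyl p q0 hp hp1 hq μ h_law γ _ n w] at key
  rw [lintegral_indicator_one hS, Measure.restrict_apply hS] at key
  exact (tendsto_nhds_unique key tendsto_const_nhds)

lemma eq_prod {Y : Type*} [Fintype Y] [MeasurableSpace Y] [MeasurableSingletonClass Y]
    (p : Y → ℝ) (hp : ∀ i, 0 ≤ p i)
    (ν : Measure (ℕ → Y))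
    (h : ∀ (n : ℕ) (w : Fin n → Y), ν (cyl w) = ENNReal.ofReal (∏ k, p (w k)))
    (m : Measure Y) [IsProbabilityMeasure m] (hm : ∀ i, m {i} = ENNReal.ofReal (p i)) :
    ν = Measure.infinitePi (fun _ : ℕ => m) := by
  classical
  have hmap : ∀ n : ℕ, ν.map (fun (ω : ℕ → Y) (k : Fin n) => ω k) = Measure.pi (fun _ => m) := by
    intro n
    refine Measure.ext_of_singleton fun w => ?_
    rw [Measure.map_apply (by fun_prop) (measurableSet_singleton _), Measure.pi_singleton]
    simp only [hm]
    rw [← ENNReal.ofReal_prod_of_nonneg (fun _ _ => hp _), ← h]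
    congr 1
    ext ω
    simp [cyl, funext_iff]
  · refine Measure.eq_infinitePi _ fun s t ht => ?_
    obtain ⟨n, hn⟩ := s.exists_nat_subset_range
    have : Set.pi (s : Set ℕ) t = (fun (ω : ℕ → Y) (k : Fin n) => ω k) ⁻¹'
        (Set.pi Set.univ (fun k : Fin n => if (k : ℕ) ∈ s then t k else Set.univ)) := by
      ext ω
      simp only [Set.mem_pi, Set.mem_preimage, Finset.mem_coe, Set.mem_univ, true_imp_iff]
      constructor
      · intro hh k
        split_ifs with hk
        · exact hh _ hk
        · trivial
      · intro hh k hk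
        have := hh ⟨k, Finset.mem_range.1 (hn hk)⟩
        simpa [hk] using this
    rw [this, ← Measure.map_apply (by fun_prop) (Set.toFinite _).measurableSet, hmap,
      Measure.pi_pi,
      Fin.prod_univ_eq_prod_range (fun k => m (if k ∈ s then t k else Set.univ)) n]
    rw [← Finset.prod_subset hn]
    · exact Finset.prod_congr rfl fun k hk => by rw [if_pos hk]
    · intro k _ hk
      rw [if_neg hk]
      exact measure_univ

lemma slln {Y : Type*} [Fintype Y] [MeasurableSpace Y] [MeasurableSingletonClass Y]
    (p : Y → ℝ) (hp : ∀ i, 0 ≤ p i) (hp1 : ∑ i, p i = 1)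
    (ν : Measure (ℕ → Y))
    (h : ∀ (n : ℕ) (w : Fin n → Y), ν (cyl w) = ENNReal.ofReal (∏ k, p (w k)))
    (f : Y → ℝ) :
    ∀ᵐ ω ∂ν, Tendsto (fun n : ℕ => (∑ k ∈ Finset.range n, f (ω k)) / n) atTop
      (𝓝 (∑ i, p i * f i)) := by
  classical
  obtain ⟨m, hmP, hm⟩ : ∃ m : Measure Y, IsProbabilityMeasure m ∧
      ∀ i, m {i} = ENNReal.ofReal (p i) := by
    refine ⟨(PMF.ofFintype (fun i => ENNReal.ofReal (p i)) (by
      rw [← ENNReal.ofReal_sum_of_nonneg (fun i _ => hp i), hp1, ENNReal.ofReal_one])).toMeasure,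
      inferInstance, fun i => ?_⟩
    rw [PMF.toMeasure_apply_singleton _ _ (measurableSet_singleton _)]
    rfl
  have hν : ν = Measure.infinitePi (fun _ : ℕ => m) := eq_prod p hp ν h m hm
  have hf : Measurable f := Measurable.of_discrete
  have hmp : ∀ k, MeasurePreserving (fun ω : ℕ → Y => ω k) ν m := fun k => by
    rw [hν]; exact measurePreserving_eval_infinitePi _ k
  have hE : ∫ ω, f (ω 0) ∂ν = ∑ i, p i * f i := by
    have h1 := integral_map (μ := ν) (hmp 0).measurable.aemeasurable
      (f := f) hf.aestronglyMeasurable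
    rw [(hmp 0).map_eq] at h1
    rw [← h1, integral_fintype Integrable.of_finite]
    refine Finset.sum_congr rfl fun i _ => ?_
    rw [measureReal_def, hm, ENNReal.toReal_ofReal (hp i), smul_eq_mul]
  have hint : Integrable (fun ω : ℕ → Y => f (ω 0)) ν :=
    ((hmp 0).integrable_comp hf.aestronglyMeasurable).2 Integrable.of_finite
  have hind : iIndepFun (fun (k : ℕ) (ω : ℕ → Y) => f (ω k)) ν := by
    rw [hν]
    exact iIndepFun_infinitePi (P := fun _ : ℕ => m) (X := fun _ => f) (fun _ => hf)
  have e : ∀ k, Measure.map (fun ω : ℕ → Y => f (ω k)) ν = Measure.map f m := fun k => by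
    rw [← (hmp k).map_eq, Measure.map_map hf (measurable_pi_apply k)]
    rfl
  have hid : ∀ k : ℕ, IdentDistrib (fun ω : ℕ → Y => f (ω k)) (fun ω : ℕ → Y => f (ω 0)) ν ν :=
    fun k => ⟨(hf.comp (measurable_pi_apply k)).aemeasurable,
      (hf.comp (measurable_pi_apply 0)).aemeasurable, by rw [e, e]⟩
  rw [← hE]
  exact strong_law_ae_real (fun (k : ℕ) (ω : ℕ → Y) => f (ω k)) hint
    (fun i j hij => hind.indepFun hij) hid

lemma core {Y P : Type*} [Fintype Y] [Fintype P] [DecidableEq P]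
    [MeasurableSpace Y] [MeasurableSingletonClass Y]
    [MeasurableSpace P] [MeasurableSingletonClass P]
    (p : Y → P → ℝ) (q0 : P → ℝ) (hp : ∀ i α, 0 ≤ p i α) (hp1 : ∀ α, ∑ i, p i α = 1)
    (hq : ∀ α, 0 ≤ q0 α) (h_pos : ∀ α β i, 0 < p i β → 0 < p i α)
    (μ : Measure (ℕ → Y)) [IsProbabilityMeasure μ]
    (h_law : ∀ (n : ℕ) (w : Fin n → Y),
      μ (cyl w) = ENNReal.ofReal (∑ α, (∏ k, p (w k) α) * q0 α))
    (Υ : (ℕ → Y) → P) (hΥ_meas : Measurable Υ)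
    (hΥ_sel : ∀ᵐ ω ∂μ, Tendsto (fun n => nwgt p q0 n ω (Υ ω)) atTop (𝓝 1))
    (hΥ_law : ∀ γ, μ {ω | Υ ω = γ} = ENNReal.ofReal (q0 γ))
    (α : P) (hα : q0 α ≠ 0) :
    (∀ γ, q0 γ ≠ 0 → ∀ (n : ℕ) (w : Fin n → Y),
        μ[|{ω | Υ ω = γ}] (cyl w) = ENNReal.ofReal (∏ k : Fin n, p (w k) γ)) ∧
      (∀ᵐ ω ∂μ,
        Tendsto (fun n : ℕ => (1 / (n : ℝ)) *
            Real.log (nwgt p q0 n ω α / nwgt p q0 n ω (Υ ω)))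
          atTop
          (𝓝 (-(∑ i, p i (Υ ω) * Real.log (p i (Υ ω) / p i α))))) := by
  have hS : ∀ γ, MeasurableSet {ω | Υ ω = γ} := fun γ => hΥ_meas (measurableSet_singleton γ)
  have h1 : ∀ γ, q0 γ ≠ 0 → ∀ (n : ℕ) (w : Fin n → Y),
        μ[|{ω | Υ ω = γ}] (cyl w) = ENNReal.ofReal (∏ k : Fin n, p (w k) γ) := by
    intro γ hγ n w
    have hγ' : 0 < q0 γ := lt_of_le_of_ne (hq γ) (Ne.symm hγ)
    rw [cond_apply (hS γ), joint_law p q0 hp hp1 hq μ h_law Υ hΥ_meas hΥ_sel, hΥ_law,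
      ENNReal.ofReal_mul (Finset.prod_nonneg fun _ _ => hp _ _), mul_comm, mul_assoc,
      ENNReal.mul_inv_cancel (by simpa using hγ') ENNReal.ofReal_ne_top, mul_one]
  refine ⟨h1, ?_⟩
  have h2 : ∀ γ, ∀ᵐ ω ∂μ, Υ ω = γ →
      Tendsto (fun n : ℕ => (∑ k ∈ Finset.range n, Real.log (p (ω k) α / p (ω k) γ)) / n) atTop
      (𝓝 (∑ i, p i γ * Real.log (p i α / p i γ))) := by
    intro γ
    by_cases hγ : q0 γ = 0
    · have : μ {ω | Υ ω = γ} = 0 := by rw [hΥ_law, hγ, ENNReal.ofReal_zero]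
      filter_upwards [measure_eq_zero_iff_ae_notMem.1 this] with ω hω hω'
      exact absurd hω' hω
    · have h3 := slln (fun i => p i γ) (fun i => hp i γ) (hp1 γ) _ (h1 γ hγ)
        (fun i => Real.log (p i α / p i γ))
      have h4 : μ.restrict {ω | Υ ω = γ} ≪ μ[|{ω | Υ ω = γ}] :=
        Measure.absolutelyContinuous_smul (ENNReal.inv_ne_zero.2 (measure_ne_top _ _))
      exact (ae_restrict_iff' (hS γ)).1 (h4.ae_le h3)
  filter_upwards [ae_all_iff.2 h2, hΥ_sel] with ω hω hsel
  have hω := hω (Υ ω) rfl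
  have hev : ∀ᶠ n in atTop, nwgt p q0 n ω (Υ ω) ≠ 0 := hsel.eventually_ne one_ne_zero
  have hq0 : q0 (Υ ω) ≠ 0 := by
    obtain ⟨n, hn⟩ := hev.exists
    intro h
    exact hn (by simp [nwgt, wgt, h])
  have hpp : ∀ k, 0 < p (ω k) (Υ ω) := by
    intro k
    obtain ⟨n, hn, hk⟩ := (hev.and (eventually_gt_atTop k)).exists
    refine lt_of_le_of_ne (hp _ _) fun h => hn ?_
    have : ∏ k ∈ Finset.range n, p (ω k) (Υ ω) = 0 :=
      Finset.prod_eq_zero (Finset.mem_range.2 hk) h.symm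
    simp [nwgt, wgt, this]
  have hpa : ∀ k, 0 < p (ω k) α := fun k => h_pos _ _ _ (hpp k)
  have hlim : Tendsto (fun n : ℕ => (∑ k ∈ Finset.range n, Real.log (p (ω k) α / p (ω k) (Υ ω))) / n
      + (1 / (n : ℝ)) * Real.log (q0 α / q0 (Υ ω))) atTop
      (𝓝 (∑ i, p i (Υ ω) * Real.log (p i α / p i (Υ ω)) + 0 * Real.log (q0 α / q0 (Υ ω)))) :=
    hω.add (tendsto_one_div_atTop_nhds_zero_nat.mul_const _)
  have heq : -(∑ i, p i (Υ ω) * Real.log (p i (Υ ω) / p i α))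
      = ∑ i, p i (Υ ω) * Real.log (p i α / p i (Υ ω)) + 0 * Real.log (q0 α / q0 (Υ ω)) := by
    rw [zero_mul, add_zero, ← Finset.sum_neg_distrib]
    refine Finset.sum_congr rfl fun i _ => ?_
    rw [← inv_div (p i (Υ ω)), Real.log_inv, mul_neg]
  rw [heq]
  refine hlim.congr' ?_
  filter_upwards [hev] with n hn
  have hZ : ∑ β, wgt p q0 n ω β ≠ 0 := fun h => hn (by simp [nwgt, h])
  have : nwgt p q0 n ω α / nwgt p q0 n ω (Υ ω)
      = (∏ k ∈ Finset.range n, (p (ω k) α / p (ω k) (Υ ω))) * (q0 α / q0 (Υ ω)) := by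
    unfold nwgt
    rw [div_div_div_cancel_right₀ hZ]
    unfold wgt
    rw [Finset.prod_div_distrib, mul_div_mul_comm]
  have hpos : ∀ k ∈ Finset.range n, p (ω k) α / p (ω k) (Υ ω) ≠ 0 :=
    fun k _ => (div_pos (hpa k) (hpp k)).ne'
  rw [this, Real.log_mul (Finset.prod_ne_zero_iff.2 hpos) (div_ne_zero hα hq0),
    Real.log_prod hpos]
  ring

/-- Real transition probabilities. -/
noncomputable def prb {Y P : Type*} [Fintype Y] (η : Y → Y → ℝ) (c : Y → P → ℂ) (i : Y) (α : P) : ℝ :=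
  ∑ j, η i j * Complex.normSq (c j α)

section
variable {d : ℕ} {Y P : Type*} [Fintype Y] [Fintype P] [DecidableEq P]
    {η : Y → Y → ℝ} {V : Y → Matrix (Fin d) (Fin d) ℂ}
    {v : P → (Fin d → ℂ)} {c : Y → P → ℂ}

set_option linter.unusedSectionVars false

lemma proj_mul (h_orth : ∀ α β, star (v α) ⬝ᵥ v β = if α = β then 1 else 0) (α β : P) :
    proj v α * proj v β = if α = β then proj v α else 0 := by
  unfold proj
  rw [Matrix.vecMulVec_mul_vecMulVec, h_orth]
  split_ifs with h
  · subst h; ext; simp [vecMulVec]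
  · ext; simp [vecMulVec]

lemma proj_herm (α : P) : (proj v α)ᴴ = proj v α := by
  ext i j; simp [proj, vecMulVec, mul_comm]

lemma proj_V (h_orth : ∀ α β, star (v α) ⬝ᵥ v β = if α = β then 1 else 0)
    (h_diag : ∀ j, V j = ∑ α, c j α • proj v α) (j : Y) (α : P) :
    proj v α * V j = c j α • proj v α := by
  rw [h_diag, Finset.mul_sum]
  simp [proj_mul h_orth]

lemma V_proj (h_orth : ∀ α β, star (v α) ⬝ᵥ v β = if α = β then 1 else 0)
    (h_diag : ∀ j, V j = ∑ α, c j α • proj v α) (j : Y) (α : P) :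
    V j * proj v α = c j α • proj v α := by
  rw [h_diag, Finset.sum_mul]
  simp [proj_mul h_orth]

lemma VH_proj (h_orth : ∀ α β, star (v α) ⬝ᵥ v β = if α = β then 1 else 0)
    (h_diag : ∀ j, V j = ∑ α, c j α • proj v α) (j : Y) (α : P) :
    (V j)ᴴ * proj v α = star (c j α) • proj v α := by
  have := congrArg conjTranspose (proj_V h_orth h_diag j α)
  rwa [conjTranspose_mul, conjTranspose_smul, proj_herm] at this

lemma trace_proj (h_orth : ∀ α β, star (v α) ⬝ᵥ v β = if α = β then 1 else 0) (α : P) :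
    (proj v α).trace = 1 := by
  unfold proj
  rw [trace_vecMulVec, dotProduct_comm, h_orth, if_pos rfl]

lemma trace_Phi (h_orth : ∀ α β, star (v α) ⬝ᵥ v β = if α = β then 1 else 0)
    (h_diag : ∀ j, V j = ∑ α, c j α • proj v α) (i : Y) (α : P)
    (ρ : Matrix (Fin d) (Fin d) ℂ) :
    (proj v α * Phi η V i ρ).trace = (prb η c i α : ℂ) * (proj v α * ρ).trace := by
  unfold Phi prb
  rw [Finset.mul_sum, trace_sum, Complex.ofReal_sum, Finset.sum_mul]
  refine Finset.sum_congr rfl fun j _ => ?_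
  rw [Matrix.mul_smul, trace_smul, smul_eq_mul, Matrix.mul_assoc, ← Matrix.mul_assoc,
    proj_V h_orth h_diag, ← Matrix.mul_assoc, trace_mul_comm, ← Matrix.mul_assoc,
    Matrix.mul_smul, VH_proj h_orth h_diag, smul_smul, Matrix.smul_mul, trace_smul, smul_eq_mul,
    Complex.ofReal_mul, Complex.normSq_eq_conj_mul_self, Complex.star_def]
  ring

lemma trace_eq (h_complete : ∑ α, proj v α = 1) (ρ : Matrix (Fin d) (Fin d) ℂ) :
    ρ.trace = ∑ α, (proj v α * ρ).trace := by
  rw [← trace_sum, ← Finset.sum_mul, h_complete, one_mul]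

lemma trace_Phi_proj (h_orth : ∀ α β, star (v α) ⬝ᵥ v β = if α = β then 1 else 0)
    (h_complete : ∑ α, proj v α = 1)
    (h_diag : ∀ j, V j = ∑ α, c j α • proj v α) (i : Y) (α : P) :
    (Phi η V i (proj v α)).trace = (prb η c i α : ℂ) := by
  rw [trace_eq h_complete, Finset.sum_eq_single α]
  · rw [trace_Phi h_orth h_diag, proj_mul h_orth, if_pos rfl, trace_proj h_orth, mul_one]
  · intro β _ hβ
    rw [trace_Phi h_orth h_diag, proj_mul h_orth, if_neg hβ]
    simp
  · simp

lemma prb_sum (hV : ∑ j, (V j)ᴴ * V j = 1) (hη_sum : ∀ j, ∑ i, η i j = 1)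
    (h_orth : ∀ α β, star (v α) ⬝ᵥ v β = if α = β then 1 else 0)
    (h_diag : ∀ j, V j = ∑ α, c j α • proj v α) (α : P) : ∑ i, prb η c i α = 1 := by
  unfold prb
  rw [Finset.sum_comm]
  simp_rw [← Finset.sum_mul, hη_sum, one_mul]
  have h := congrArg (fun M => (M * proj v α).trace) hV
  simp only [Finset.sum_mul, trace_sum, one_mul, trace_proj h_orth] at h
  have h2 : ∀ j, ((V j)ᴴ * V j * proj v α).trace = (Complex.normSq (c j α) : ℂ) := by
    intro j
    rw [Matrix.mul_assoc, V_proj h_orth h_diag, Matrix.mul_smul, VH_proj h_orth h_diag, smul_smul,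
      trace_smul, trace_proj h_orth, Complex.normSq_eq_conj_mul_self, mul_comm (c j α)]
    simp
  simp_rw [h2] at h
  exact_mod_cast h

lemma q_nonneg {ρ0 : Matrix (Fin d) (Fin d) ℂ} (hρ0 : ρ0.PosSemidef) (α : P) :
    0 ≤ (proj v α * ρ0).trace := by
  have := hρ0.dotProduct_mulVec_nonneg (v α)
  unfold proj
  rwa [trace_mul_comm, Matrix.mul_vecMulVec, trace_vecMulVec, dotProduct_comm]

lemma evolve_tr (h_orth : ∀ α β, star (v α) ⬝ᵥ v β = if α = β then 1 else 0)
    (h_diag : ∀ j, V j = ∑ α, c j α • proj v α) (α : P) (l : List Y) :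
    ∀ ρ : Matrix (Fin d) (Fin d) ℂ, (proj v α * evolve η V ρ l).trace
      = ((l.map (fun i => prb η c i α)).prod : ℝ) * (proj v α * ρ).trace := by
  induction l with
  | nil => intro ρ; simp [evolve]
  | cons i l ih =>
    intro ρ
    have := ih (Phi η V i ρ)
    rw [trace_Phi h_orth h_diag] at this
    rw [show evolve η V ρ (i :: l) = evolve η V (Phi η V i ρ) l from rfl, this]
    simp only [List.map_cons, List.prod_cons, Complex.ofReal_mul]
    ring

lemma traj_tr (hη_nonneg : ∀ i j, 0 ≤ η i j)
    (h_orth : ∀ α β, star (v α) ⬝ᵥ v β = if α = β then 1 else 0)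
    (h_complete : ∑ α, proj v α = 1)
    (h_diag : ∀ j, V j = ∑ α, c j α • proj v α)
    {ρ0 : Matrix (Fin d) (Fin d) ℂ} (q0 : P → ℝ) (hq : ∀ α, 0 ≤ q0 α) (hq1 : ∑ α, q0 α = 1)
    (hq0 : ∀ α, (proj v α * ρ0).trace = (q0 α : ℂ)) (ω : ℕ → Y) (n : ℕ) :
    ∀ α, (proj v α * traj η V ρ0 n ω).trace = (nwgt (prb η c) q0 n ω α : ℂ) := by
  have hp : ∀ i (α : P), 0 ≤ prb η c i α := fun i α =>
    Finset.sum_nonneg fun j _ => mul_nonneg (hη_nonneg _ _) (Complex.normSq_nonneg _)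
  induction n with
  | zero =>
    intro α
    simp [traj, nwgt, wgt, hq1, hq0]
  | succ n ih =>
    intro α
    simp only [traj]
    rw [Matrix.mul_smul, trace_smul, trace_eq h_complete (Phi _ _ _ _)]
    simp_rw [trace_Phi h_orth h_diag, ih]
    rw [smul_eq_mul]
    norm_cast
    have hw : ∀ β, wgt (prb η c) q0 (n + 1) ω β = prb η c (ω n) β * wgt (prb η c) q0 n ω β := by
      intro β
      unfold wgt
      rw [Finset.prod_range_succ]
      ring
    unfold nwgt
    simp_rw [hw]
    by_cases hZ : ∑ β, wgt (prb η c) q0 n ω β = 0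
    · have := (Finset.sum_eq_zero_iff_of_nonneg fun a _ => wgt_nonneg hp hq n ω a).1 hZ α
        (Finset.mem_univ _)
      simp [this]
    · simp_rw [← mul_div_assoc]
      rw [← Finset.sum_div, inv_mul_eq_div, div_right_comm, div_div_div_cancel_right₀ hZ]

end

end Helpers

/-- exponential speed of selection. Conditionally on `{Υ = γ}`
the outcomes are i.i.d. with law `p(·|γ)` (expressed through the cylinder
probabilities of the conditional measure), and for `α` with `q_α(0) ≠ 0`,
almost surely `(1/n) ln(q_α(n)/q_Υ(n)) → -S(ℙ_Υ‖ℙ_α)`. -/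
theorem stmt14 {d : ℕ} {Y P : Type*} [Fintype Y] [Fintype P] [DecidableEq P]
    [MeasurableSpace Y] [MeasurableSingletonClass Y]
    [MeasurableSpace P] [MeasurableSingletonClass P]
    (η : Y → Y → ℝ) (V : Y → Matrix (Fin d) (Fin d) ℂ)
    (v : P → (Fin d → ℂ)) (c : Y → P → ℂ)
    (hV : ∑ j, (V j)ᴴ * V j = 1)
    (hη_nonneg : ∀ i j, 0 ≤ η i j) (hη_sum : ∀ j, ∑ i, η i j = 1)
    (h_orth : ∀ α β, star (v α) ⬝ᵥ v β = if α = β then 1 else 0)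
    (h_complete : ∑ α, proj v α = 1)
    (h_diag : ∀ j, V j = ∑ α, c j α • proj v α)
    (h_nondeg : ∀ α β, α ≠ β →
      ∃ i, (Phi η V i (proj v α)).trace ≠ (Phi η V i (proj v β)).trace)
    (h_pos : ∀ α β i, 0 < (Phi η V i (proj v β)).trace.re →
      0 < (Phi η V i (proj v α)).trace.re)
    (ρ0 : Matrix (Fin d) (Fin d) ℂ) (hρ0 : ρ0.PosSemidef) (hρ0tr : ρ0.trace = 1)
    (μ : Measure (ℕ → Y)) [IsProbabilityMeasure μ]
    (h_law : ∀ (n : ℕ) (w : Fin n → Y),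
      μ (cyl w) = ENNReal.ofReal ((evolve η V ρ0 (List.ofFn w)).trace.re))
    -- `Υ` is the pointer state selected by the trajectory, as in the selection
    -- theorem:
    (Υ : (ℕ → Y) → P) (hΥ_meas : Measurable Υ)
    (hΥ_sel : ∀ᵐ ω ∂μ,
      Tendsto (fun n => (proj v (Υ ω) * traj η V ρ0 n ω).trace.re) atTop (𝓝 1))
    (hΥ_law : ∀ γ, μ {ω | Υ ω = γ} = ENNReal.ofReal ((proj v γ * ρ0).trace.re))
    (α : P) (hα : (proj v α * ρ0).trace.re ≠ 0) :
    (∀ γ, (proj v γ * ρ0).trace.re ≠ 0 → ∀ (n : ℕ) (w : Fin n → Y),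
        μ[|{ω | Υ ω = γ}] (cyl w)
          = ENNReal.ofReal (∏ k : Fin n, (Phi η V (w k) (proj v γ)).trace.re)) ∧
      (∀ᵐ ω ∂μ,
        Tendsto (fun n : ℕ => (1 / (n : ℝ)) *
            Real.log ((proj v α * traj η V ρ0 n ω).trace.re
              / (proj v (Υ ω) * traj η V ρ0 n ω).trace.re))
          atTop
          (𝓝 (-(∑ i, (Phi η V i (proj v (Υ ω))).trace.re *
            Real.log ((Phi η V i (proj v (Υ ω))).trace.re
              / (Phi η V i (proj v α)).trace.re))))) := by
  have hp : ∀ i (α : P), 0 ≤ prb η c i α := fun i α =>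
    Finset.sum_nonneg fun j _ => mul_nonneg (hη_nonneg _ _) (Complex.normSq_nonneg _)
  have hq : ∀ α, 0 ≤ (proj v α * ρ0).trace.re := fun α =>
    (Complex.nonneg_iff.1 (q_nonneg hρ0 α)).1
  have hq0 : ∀ α, (proj v α * ρ0).trace = ((proj v α * ρ0).trace.re : ℂ) := fun α =>
    Complex.ext (by simp) (by simpa using (Complex.nonneg_iff.1 (q_nonneg hρ0 α)).2.symm)
  have hq1 : ∑ α, (proj v α * ρ0).trace.re = 1 := by
    rw [← Complex.re_sum, ← trace_eq h_complete, hρ0tr, Complex.one_re]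
  have hT : ∀ (α : P) n ω, (proj v α * traj η V ρ0 n ω).trace.re
      = nwgt (prb η c) (fun α => (proj v α * ρ0).trace.re) n ω α := by
    intro α n ω
    rw [traj_tr hη_nonneg h_orth h_complete h_diag _ hq hq1 hq0, Complex.ofReal_re]
  have hPhi : ∀ i α, (Phi η V i (proj v α)).trace.re = prb η c i α := by
    intro i α
    rw [trace_Phi_proj h_orth h_complete h_diag, Complex.ofReal_re]
  have hlaw' : ∀ (n : ℕ) (w : Fin n → Y),
      μ (cyl w) = ENNReal.ofReal (∑ α, (∏ k, prb η c (w k) α) * (proj v α * ρ0).trace.re) := by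
    intro n w
    rw [h_law, trace_eq h_complete, Complex.re_sum]
    congr 1
    refine Finset.sum_congr rfl fun α _ => ?_
    rw [evolve_tr h_orth h_diag, Complex.re_ofReal_mul, List.map_ofFn, List.prod_ofFn]
    rfl
  simp_rw [hT] at hΥ_sel
  simp_rw [hPhi] at h_pos
  simp_rw [hT, hPhi]
  exact core (prb η c) (fun α => (proj v α * ρ0).trace.re) hp (prb_sum hV hη_sum h_orth h_diag) hq
    h_pos μ hlaw' Υ hΥ_meas hΥ_sel hΥ_law α hα
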